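/- With γ the irreducibility coefficient of a finite-state finite-action stochastic game (γ = min_{i,j} inf over strategies of P_i(τ_j ≤ |E|)), γ > 0 holds if and only if for every deterministic stationary strategy pair (f, g) the induced Markov chain on E is irreducible. -/

import Mathlib

/-- The avoidance value iteration `V_kʲ`. -/
noncomputable def Vav {E α β : Type*} [Fintype E] [DecidableEq E]
    (P : E → α → β → E → ℝ) (A : E → Finset α) (B : E → Finset β)
    (hA : ∀ i, (A i).Nonempty) (hB : ∀ i, (B i).Nonempty) (j : E) : ℕ → E → ℝ
  | 0, _ => 1
  | k+1, i => ((A i) ×ˢ (B i)).sup' ((hA i).product (hB i))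
      fun ab => ∑ i₁ ∈ Finset.univ.erase j, P i ab.1 ab.2 i₁ * Vav P A B hA hB j k i₁

/-- A randomized history-dependent strategy for player 1: given the history of
(state, action, action) triples and the current state, a probability distribution
supported on the admissible actions `A i`. -/
def IsStrat1 {E α β : Type*} (A : E → Finset α) (π : List (E × α × β) → E → α → ℝ) : Prop :=
  ∀ hist i, (∀ a, 0 ≤ π hist i a) ∧ (∑ a ∈ A i, π hist i a = 1) ∧
    ∀ a, a ∉ A i → π hist i a = 0

/-- A randomized history-dependent strategy for player 2. -/
def IsStrat2 {E α β : Type*} (B : E → Finset β) (σ : List (E × α × β) → E → β → ℝ) : Prop :=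
  ∀ hist i, (∀ b, 0 ≤ σ hist i b) ∧ (∑ b ∈ B i, σ hist i b = 1) ∧
    ∀ b, b ∉ B i → σ hist i b = 0

/-- `avoidQ P A B j π σ k hist i` is the probability, under the strategy pair `(π, σ)`
with accumulated history `hist` and current state `i`, that the chain does not visit `j`
during the next `k` steps; so `P_i^{π,σ}(τ_j ≤ k) = 1 - avoidQ P A B j π σ k [] i`. -/
noncomputable def avoidQ {E α β : Type*} [Fintype E] [DecidableEq E]
    (P : E → α → β → E → ℝ) (A : E → Finset α) (B : E → Finset β) (j : E)
    (π : List (E × α × β) → E → α → ℝ) (σ : List (E × α × β) → E → β → ℝ) :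
    ℕ → List (E × α × β) → E → ℝ
  | 0, _, _ => 1
  | k+1, hist, i => ∑ a ∈ A i, ∑ b ∈ B i, π hist i a * σ hist i b *
      ∑ i₁ ∈ Finset.univ.erase j, P i a b i₁ * avoidQ P A B j π σ k (hist ++ [(i, a, b)]) i₁


open Classical in
theorem isStrat1_pure {E α β : Type*} {A : E → Finset α} {f : E → α}
    (hf : ∀ s, f s ∈ A s) : IsStrat1 (β := β) A fun _ s => Pi.single (f s) 1 := by
  refine fun _ s => ⟨fun a => ?_, ?_, fun a ha => ?_⟩
  · dsimp only
    rw [Pi.single_apply]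
    split_ifs <;> norm_num
  · simp [hf s]
  · exact Pi.single_eq_of_ne (fun h : a = f s => ha (h ▸ hf s)) _

open Classical in
theorem isStrat2_pure {E α β : Type*} {B : E → Finset β} {g : E → β}
    (hg : ∀ s, g s ∈ B s) : IsStrat2 (α := α) B fun _ s => Pi.single (g s) 1 := by
  refine fun _ s => ⟨fun b => ?_, ?_, fun b hb => ?_⟩
  · dsimp only
    rw [Pi.single_apply]
    split_ifs <;> norm_num
  · simp [hg s]
  · exact Pi.single_eq_of_ne (fun h : b = g s => hb (h ▸ hg s)) _

section AvoidanceIteration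

variable {E α β : Type*} [Fintype E] [DecidableEq E]

theorem sum_erase_mul_le_one {p v : E → ℝ} (hp : ∀ s, 0 ≤ p s) (hsum : ∑ s, p s = 1)
    (hv : ∀ s, v s ≤ 1) (j : E) : ∑ s ∈ Finset.univ.erase j, p s * v s ≤ 1 := by
  rw [← hsum, ← Finset.add_sum_erase _ p (Finset.mem_univ j)]
  have h : ∑ s ∈ Finset.univ.erase j, p s * v s ≤ ∑ s ∈ Finset.univ.erase j, p s :=
    Finset.sum_le_sum fun s _ => mul_le_of_le_one_right (hp s) (hv s)
  linarith [hp j]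

theorem of_sum_erase_mul_eq_one {p v : E → ℝ} (hp : ∀ s, 0 ≤ p s) (hsum : ∑ s, p s = 1)
    (hv : ∀ s, v s ≤ 1) {j : E} (h : ∑ s ∈ Finset.univ.erase j, p s * v s = 1) {t : E}
    (ht : 0 < p t) : t ≠ j ∧ v t = 1 := by
  rw [← Finset.add_sum_erase _ p (Finset.mem_univ j)] at hsum
  have hnn : ∀ s ∈ Finset.univ.erase j, 0 ≤ p s * (1 - v s) := fun s _ =>
    mul_nonneg (hp s) (sub_nonneg.2 (hv s))
  have hsplit : ∑ s ∈ Finset.univ.erase j, p s * (1 - v s) = - p j := by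
    simp only [mul_sub, mul_one, Finset.sum_sub_distrib]
    linarith
  have hpj : p j = 0 := by linarith [Finset.sum_nonneg hnn, hp j]
  have htj : t ≠ j := by
    rintro rfl
    exact ht.ne' hpj
  refine ⟨htj, ?_⟩
  rw [hpj, neg_zero, Finset.sum_eq_zero_iff_of_nonneg hnn] at hsplit
  have := (mul_eq_zero.1 (hsplit t (by simp [htj]))).resolve_left ht.ne'
  linarith

variable {P : E → α → β → E → ℝ} {A : E → Finset α} {B : E → Finset β}
  (hA : ∀ i, (A i).Nonempty) (hB : ∀ i, (B i).Nonempty)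

theorem Vav_le_one (hPnn : ∀ i a b s, 0 ≤ P i a b s) (hPsum : ∀ i a b, ∑ s, P i a b s = 1)
    (j : E) (k : ℕ) (i : E) : Vav P A B hA hB j k i ≤ 1 := by
  induction k generalizing i with
  | zero => simp [Vav]
  | succ k ih =>
    exact Finset.sup'_le _ _ fun ab _ => sum_erase_mul_le_one (hPnn i _ _) (hPsum i _ _) ih j

theorem Vav_succ_le (hPnn : ∀ i a b s, 0 ≤ P i a b s) (hPsum : ∀ i a b, ∑ s, P i a b s = 1)
    (j : E) (k : ℕ) (i : E) : Vav P A B hA hB j (k + 1) i ≤ Vav P A B hA hB j k i := by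
  induction k generalizing i with
  | zero => exact Vav_le_one hA hB hPnn hPsum j 1 i
  | succ k ih =>
    exact Finset.sup'_mono_fun fun ab _ => Finset.sum_le_sum fun s _ =>
      mul_le_mul_of_nonneg_left (ih s) (hPnn _ _ _ _)

theorem avoidQ_le_Vav (hPnn : ∀ i a b s, 0 ≤ P i a b s) {π : List (E × α × β) → E → α → ℝ}
    {σ : List (E × α × β) → E → β → ℝ} (hπ : IsStrat1 A π) (hσ : IsStrat2 B σ) (j : E) (k : ℕ)
    (hist : List (E × α × β)) (i : E) :
    avoidQ P A B j π σ k hist i ≤ Vav P A B hA hB j k i := by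
  induction k generalizing hist i with
  | zero => simp [avoidQ, Vav]
  | succ k ih =>
    calc avoidQ P A B j π σ (k + 1) hist i
        ≤ ∑ a ∈ A i, ∑ b ∈ B i, π hist i a * σ hist i b * Vav P A B hA hB j (k + 1) i := by
          refine Finset.sum_le_sum fun a ha => Finset.sum_le_sum fun b hb =>
            mul_le_mul_of_nonneg_left ?_ (mul_nonneg ((hπ hist i).1 a) ((hσ hist i).1 b))
          refine (Finset.sum_le_sum fun s _ =>
            mul_le_mul_of_nonneg_left (ih _ s) (hPnn i a b s)).trans ?_
          exact Finset.le_sup' (fun ab : α × β => ∑ i₁ ∈ Finset.univ.erase j,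
            P i ab.1 ab.2 i₁ * Vav P A B hA hB j k i₁)
            (Finset.mk_mem_product ha hb)
      _ = Vav P A B hA hB j (k + 1) i := by
          simp only [← Finset.sum_mul, ← Finset.mul_sum, (hπ hist i).2.1, (hσ hist i).2.1, one_mul]

theorem exists_actions_of_Vav_succ_eq_one (hPnn : ∀ i a b s, 0 ≤ P i a b s)
    (hPsum : ∀ i a b, ∑ s, P i a b s = 1) {j : E} {k : ℕ} {i : E}
    (h : Vav P A B hA hB j (k + 1) i = 1) :
    ∃ a ∈ A i, ∃ b ∈ B i, ∀ t, 0 < P i a b t → t ≠ j ∧ Vav P A B hA hB j k t = 1 := by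
  obtain ⟨ab, hab, heq⟩ := Finset.exists_mem_eq_sup' ((hA i).product (hB i))
    fun ab : α × β => ∑ i₁ ∈ Finset.univ.erase j, P i ab.1 ab.2 i₁ * Vav P A B hA hB j k i₁
  rw [Finset.mem_product] at hab
  refine ⟨ab.1, hab.1, ab.2, hab.2, fun t ht => ?_⟩
  exact of_sum_erase_mul_eq_one (hPnn i _ _) (hPsum i _ _) (Vav_le_one hA hB hPnn hPsum j k)
    (heq.symm.trans h) ht

/-- A decreasing sequence of finite sets that is nonempty at time `|E|` has stalled before. -/
theorem exists_succ_eq_of_antitone {S : ℕ → Finset E} (hS : ∀ k, S (k + 1) ⊆ S k)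
    (hne : (S (Fintype.card E)).Nonempty) : ∃ k < Fintype.card E, S (k + 1) = S k := by
  by_contra! hcon
  have key : ∀ k ≤ Fintype.card E, (S k).card + k ≤ Fintype.card E := by
    intro k
    induction k with
    | zero => intro _; simpa using Finset.card_le_univ (S 0)
    | succ k ih =>
      intro hk
      have := ih (by omega)
      have := Finset.card_lt_card ((hS k).ssubset_of_ne (hcon k (by omega)))
      omega
  have := key _ le_rfl
  have := hne.card_pos
  omega

/-- If some state has avoidance value `1` at horizon `|E|`, then a stationary pair keeps the
chain forever in a nonempty set, without entering `j`. -/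
theorem exists_stationary_closed (hPnn : ∀ i a b s, 0 ≤ P i a b s)
    (hPsum : ∀ i a b, ∑ s, P i a b s = 1) {i j : E}
    (h : Vav P A B hA hB j (Fintype.card E) i = 1) :
    ∃ (f : E → α) (g : E → β) (S : Set E), (∀ s, f s ∈ A s) ∧ (∀ s, g s ∈ B s) ∧ i ∈ S ∧
      ∀ s ∈ S, ∀ t, 0 < P s (f s) (g s) t → t ≠ j ∧ t ∈ S := by
  classical
  let S : ℕ → Finset E := fun k => Finset.univ.filter fun s => Vav P A B hA hB j k s = 1
  have hS : ∀ k, S (k + 1) ⊆ S k := fun k s hs => by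
    simp only [S, Finset.mem_filter, Finset.mem_univ, true_and] at hs ⊢
    exact le_antisymm (Vav_le_one hA hB hPnn hPsum j k s)
      (hs ▸ Vav_succ_le hA hB hPnn hPsum j k s)
  have hi : i ∈ S (Fintype.card E) := by simp [S, h]
  obtain ⟨k, hk, hkS⟩ := exists_succ_eq_of_antitone hS ⟨i, hi⟩
  have hex : ∀ s, ∃ a ∈ A s, ∃ b ∈ B s, s ∈ S k → ∀ t, 0 < P s a b t → t ≠ j ∧ t ∈ S k := by
    intro s
    by_cases hs : s ∈ S k
    · have hs' : Vav P A B hA hB j (k + 1) s = 1 := by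
        rw [← hkS] at hs
        simpa [S] using hs
      obtain ⟨a, ha, b, hb, hab⟩ := exists_actions_of_Vav_succ_eq_one hA hB hPnn hPsum hs'
      exact ⟨a, ha, b, hb, fun _ t ht => by simpa [S] using hab t ht⟩
    · obtain ⟨a, ha⟩ := hA s
      obtain ⟨b, hb⟩ := hB s
      exact ⟨a, ha, b, hb, fun h => absurd h hs⟩
  choose f hf g hg hfg using hex
  exact ⟨f, g, S k, hf, hg, antitone_nat_of_succ_le hS hk.le hi, fun s hs => hfg s hs⟩

theorem pow_apply_eq_zero_of_closed {M : Matrix E E ℝ} (hM : ∀ s t, 0 ≤ M s t) {S : Set E} {j : E}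
    (hS : ∀ s ∈ S, ∀ t, 0 < M s t → t ≠ j ∧ t ∈ S) {n : ℕ} (hn : 0 < n) {s : E} (hs : s ∈ S) :
    (M ^ n) s j = 0 := by
  induction n, hn using Nat.le_induction generalizing s with
  | base =>
    rw [Nat.succ_eq_add_one, zero_add, pow_one]
    exact le_antisymm (not_lt.1 fun h => (hS s hs j h).1 rfl) (hM s j)
  | succ n _ ih =>
    rw [pow_succ', Matrix.mul_apply]
    refine Finset.sum_eq_zero fun t _ => ?_
    rcases (hM s t).eq_or_lt with h | h
    · rw [← h, zero_mul]
    · rw [ih (hS s hs t h).2, mul_zero]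

theorem pow_apply_nonneg {M : Matrix E E ℝ} (hM : ∀ s t, 0 ≤ M s t) (n : ℕ) (s t : E) :
    0 ≤ (M ^ n) s t := by
  induction n generalizing s with
  | zero => rw [pow_zero, Matrix.one_apply]; split_ifs <;> norm_num
  | succ n ih =>
    rw [pow_succ', Matrix.mul_apply]
    exact Finset.sum_nonneg fun u _ => mul_nonneg (hM s u) (ih u)

/-- The states from which `j` is unreachable form a closed set not leading into `j`. -/
theorem closed_of_unreachable {M : Matrix E E ℝ} (hM : ∀ s t, 0 ≤ M s t) {j s t : E}
    (hs : ∀ n, 0 < n → (M ^ n) s j = 0) (hst : 0 < M s t) :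
    t ≠ j ∧ ∀ n, 0 < n → (M ^ n) t j = 0 := by
  constructor
  · rintro rfl
    exact hst.ne' (by simpa using hs 1 one_pos)
  · intro n _
    have h := hs (n + 1) n.succ_pos
    rw [pow_succ', Matrix.mul_apply, Finset.sum_eq_zero_iff_of_nonneg fun u _ =>
      mul_nonneg (hM s u) (pow_apply_nonneg hM n u j)] at h
    exact (mul_eq_zero.1 (h t (Finset.mem_univ t))).resolve_left hst.ne'

open Classical in
theorem avoidQ_pure_eq_one (hPnn : ∀ i a b s, 0 ≤ P i a b s)
    (hPsum : ∀ i a b, ∑ s, P i a b s = 1) {f : E → α} {g : E → β} (hf : ∀ s, f s ∈ A s)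
    (hg : ∀ s, g s ∈ B s) {S : Set E} {j : E}
    (hS : ∀ s ∈ S, ∀ t, 0 < P s (f s) (g s) t → t ≠ j ∧ t ∈ S) (k : ℕ)
    (hist : List (E × α × β)) {s : E} (hs : s ∈ S) :
    avoidQ P A B j (fun _ s => Pi.single (f s) 1) (fun _ s => Pi.single (g s) 1) k hist s = 1 := by
  induction k generalizing hist s with
  | zero => rfl
  | succ k ih =>
    rw [avoidQ, Finset.sum_eq_single_of_mem (f s) (hf s)
      fun a _ ha => by simp [Pi.single_eq_of_ne ha],
      Finset.sum_eq_single_of_mem (g s) (hg s) fun b _ hb => by simp [Pi.single_eq_of_ne hb],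
      Pi.single_eq_same, Pi.single_eq_same, one_mul, one_mul]
    refine Eq.trans ?_ (hPsum s (f s) (g s))
    rw [← Finset.sum_erase (a := j) Finset.univ
      (le_antisymm (not_lt.1 fun h => (hS s hs j h).1 rfl) (hPnn s (f s) (g s) j))]
    refine Finset.sum_congr rfl fun t _ => ?_
    rcases (hPnn s (f s) (g s) t).eq_or_lt with h | h
    · rw [← h, zero_mul]
    · rw [ih _ (hS s hs t h).2, mul_one]

end AvoidanceIteration

/-- `γ > 0` if and only if for every deterministic stationary strategy
pair `(f, g)` the induced Markov chain `P_{f,g}(i,j) = P(j|i,f(i),g(i))` is irreducible.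
Here `γ` is characterized as the greatest lower bound defining the irreducibility
coefficient `min_{(i,j)} inf_{π,σ} P_i^{π,σ}(τ_j ≤ |E|)`. -/
theorem stmt_11 {E α β : Type*} [Fintype E] [DecidableEq E] [Nonempty E]
    (P : E → α → β → E → ℝ) (A : E → Finset α) (B : E → Finset β)
    (hA : ∀ i, (A i).Nonempty) (hB : ∀ i, (B i).Nonempty)
    (hPnn : ∀ i a b s, 0 ≤ P i a b s) (hPsum : ∀ i a b, ∑ s, P i a b s = 1)
    (γ : ℝ)
    (hγ : IsGLB {x : ℝ | ∃ (i j : E) (π : List (E × α × β) → E → α → ℝ)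
        (σ : List (E × α × β) → E → β → ℝ), IsStrat1 A π ∧ IsStrat2 B σ ∧
        x = 1 - avoidQ P A B j π σ (Fintype.card E) [] i} γ) :
    0 < γ ↔ ∀ (f : E → α) (g : E → β), (∀ i, f i ∈ A i) → (∀ i, g i ∈ B i) →
      ∀ i j : E, ∃ n : ℕ, 0 < n ∧
        0 < ((Matrix.of fun s t => P s (f s) (g s) t) ^ n) i j := by
  classical
  constructor
  · intro hpos f g hf hg i j
    have hM : ∀ s t, 0 ≤ Matrix.of (fun s t => P s (f s) (g s) t) s t := fun s t => hPnn _ _ _ _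
    by_contra! hcon
    have hzero : i ∈ {s | ∀ n, 0 < n → (Matrix.of (fun s t => P s (f s) (g s) t) ^ n) s j = 0} :=
      fun n hn => le_antisymm (hcon n hn) (pow_apply_nonneg hM n i j)
    have hQ := avoidQ_pure_eq_one hPnn hPsum hf hg
      (fun s hs t hst => closed_of_unreachable hM hs hst) (Fintype.card E) [] hzero
    refine hpos.not_ge (hγ.1 ⟨i, j, _, _, isStrat1_pure hf, isStrat2_pure hg, ?_⟩)
    rw [hQ, sub_self]
  · intro hirr
    have hlt : ∀ i j, Vav P A B hA hB j (Fintype.card E) i < 1 := by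
      refine fun i j => (Vav_le_one hA hB hPnn hPsum j _ i).lt_of_ne fun h => ?_
      obtain ⟨f, g, S, hf, hg, hi, hS⟩ := exists_stationary_closed hA hB hPnn hPsum h
      obtain ⟨n, hn, hpos⟩ := hirr f g hf hg i j
      exact hpos.ne' (pow_apply_eq_zero_of_closed (fun s t => hPnn _ _ _ _) hS hn hi)
    obtain ⟨m, hm⟩ := Finite.exists_max
      fun ij : E × E => Vav P A B hA hB ij.2 (Fintype.card E) ij.1
    refine (sub_pos.2 (hlt m.1 m.2)).trans_le (hγ.2 ?_)
    rintro x ⟨i, j, π, σ, hπ, hσ, rfl⟩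
    exact sub_le_sub_left
      ((avoidQ_le_Vav hA hB hPnn hπ hσ j _ [] i).trans (hm (i, j))) 1
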